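/- (Proposition 3.3) Let n, m ≥ 1, let f : ℝ^n × ℝ^m → ℝ^n be continuous, let g : ℝ^n × ℝ^m → ℝ^m be continuously differentiable, let r : ℝ → ℝ^m be differentiable, let T > 0 and α > 0, let E₂ : [0,∞) → ℝ^m be continuous with η₂ := limsup_{t→∞} ‖E₂(t)‖, and let x : [0,∞) → ℝ^n and u : [0,∞) → ℝ^m be differentiable functions satisfying, for every t ≥ 0: ẋ(t) = f(x(t),u(t)); D_u g(x(t),u(t)) is invertible; and u̇(t) = (D_u g(x(t),u(t)))⁻¹ ( α (r(t+T) − g(x(t),u(t))) + ṙ(t+T) − D_x g(x(t),u(t)) f(x(t),u(t)) + E₂(t) ). Then limsup_{t→∞} ‖r(t+T) − g(x(t),u(t))‖ ≤ η₂ / α. -/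

import Mathlib

open Filter Topology ENNReal

/-- Exponential decay estimate for `e' = -α e - d` when the disturbance satisfies `‖d‖ ≤ α c`. -/
theorem norm_le_exp_mul_add_of_hasDerivAt {V : Type*} [NormedAddCommGroup V] [NormedSpace ℝ V]
    {e d : ℝ → V} {α c t₀ : ℝ}
    (he : ∀ t, t₀ ≤ t → HasDerivAt e (-(α • e t) - d t) t)
    (hd : ∀ t, t₀ ≤ t → ‖d t‖ ≤ α * c) {t : ℝ} (ht : t₀ ≤ t) :
    ‖e t‖ ≤ Real.exp (-(α * t)) * (Real.exp (α * t₀) * (‖e t₀‖ - c)) + c := by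
  have hexp (s : ℝ) : HasDerivAt (fun s => Real.exp (α * s)) (Real.exp (α * s) * α) s := by
    simpa using ((hasDerivAt_id s).const_mul α).exp
  have hw (s : ℝ) (hs : t₀ ≤ s) :
      HasDerivAt (fun s => Real.exp (α * s) • e s) (-(Real.exp (α * s) • d s)) s :=
    ((hexp s).smul (he s hs)).congr_deriv (by module)
  have hB (s : ℝ) : HasDerivAt
      (fun s => Real.exp (α * s) * c + Real.exp (α * t₀) * (‖e t₀‖ - c))
      (Real.exp (α * s) * α * c) s := ((hexp s).mul_const c).add_const _
  have key := image_norm_le_of_norm_deriv_right_le_deriv_boundary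
    (a := t₀) (b := t) (fun s hs => (hw s hs.1).continuousAt.continuousWithinAt)
    (fun s hs => (hw s hs.1).hasDerivWithinAt)
    (by
      rw [norm_smul, Real.norm_of_nonneg (Real.exp_pos _).le]
      exact le_of_eq (by ring))
    hB
    (fun s hs => by
      rw [norm_neg, norm_smul, Real.norm_of_nonneg (Real.exp_pos _).le, mul_assoc]
      exact mul_le_mul_of_nonneg_left (hd s hs.1) (Real.exp_pos _).le)
    (Set.right_mem_Icc.2 ht)
  rw [norm_smul, Real.norm_of_nonneg (Real.exp_pos _).le] at key
  have hinv : Real.exp (-(α * t)) * Real.exp (α * t) = 1 := by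
    rw [← Real.exp_add, neg_add_cancel, Real.exp_zero]
  calc ‖e t‖ = Real.exp (-(α * t)) * (Real.exp (α * t) * ‖e t‖) := by
        rw [← mul_assoc, hinv, one_mul]
    _ ≤ Real.exp (-(α * t)) *
        (Real.exp (α * t) * c + Real.exp (α * t₀) * (‖e t₀‖ - c)) :=
        mul_le_mul_of_nonneg_left key (Real.exp_pos _).le
    _ = _ := by rw [mul_add, ← mul_assoc, hinv, one_mul, add_comm]

/-- Solutions of `e' = -α e - d` with `α > 0` are asymptotically bounded by `limsup ‖d‖ / α`. -/
theorem limsup_nnnorm_le_div_of_hasDerivAt {V : Type*} [NormedAddCommGroup V] [NormedSpace ℝ V]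
    {e d : ℝ → V} {α : ℝ} (hα : 0 < α)
    (he : ∀ t, 0 ≤ t → HasDerivAt e (-(α • e t) - d t) t) :
    limsup (fun t => (‖e t‖₊ : ℝ≥0∞)) atTop ≤
      limsup (fun t => (‖d t‖₊ : ℝ≥0∞)) atTop / ENNReal.ofReal α := by
  have hα₀ : ENNReal.ofReal α ≠ 0 := by simpa using hα
  refine le_of_forall_gt_imp_ge_of_dense fun a ha => ?_
  rcases eq_or_ne a ⊤ with rfl | ha_top
  · exact le_top
  lift a to NNReal using ha_top
  rw [ENNReal.div_lt_iff (.inl hα₀) (.inl ENNReal.ofReal_ne_top)] at ha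
  obtain ⟨t₁, ht₁⟩ := eventually_atTop.1 (eventually_lt_of_limsup_lt ha)
  have hd (t : ℝ) (ht : max t₁ 0 ≤ t) : ‖d t‖ ≤ α * a := by
    have h := (ht₁ t ((le_max_left _ _).trans ht)).le
    rw [ENNReal.ofReal, ← ENNReal.coe_mul, ENNReal.coe_le_coe, ← NNReal.coe_le_coe] at h
    simpa [hα.le, mul_comm] using h
  have hlim (K : ℝ) : Tendsto (fun t => ENNReal.ofReal (Real.exp (-(α * t)) * K + a)) atTop
      (𝓝 (a : ℝ≥0∞)) := by
    have h := ((Real.tendsto_exp_neg_atTop_nhds_zero.comp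
      (tendsto_id.const_mul_atTop hα)).mul_const K).add_const (a : ℝ)
    simpa [Function.comp_def] using ENNReal.tendsto_ofReal h
  rw [← (hlim (Real.exp (α * max t₁ 0) * (‖e (max t₁ 0)‖ - a))).limsup_eq]
  refine limsup_le_limsup ?_
  filter_upwards [eventually_ge_atTop (max t₁ 0)] with t ht
  rw [← enorm_eq_nnnorm, ← ofReal_norm]
  exact ENNReal.ofReal_le_ofReal <| norm_le_exp_mul_add_of_hasDerivAt
    (fun s hs => he s ((le_max_right _ _).trans hs)) hd ht

/-- Chain rule along a curve, in terms of the two partial derivatives. -/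
theorem hasDerivAt_comp_prodMk_partial {X U Y : Type*}
    [NormedAddCommGroup X] [NormedSpace ℝ X] [NormedAddCommGroup U] [NormedSpace ℝ U]
    [NormedAddCommGroup Y] [NormedSpace ℝ Y] {g : X × U → Y} {x : ℝ → X} {u : ℝ → U}
    {x' : X} {u' : U} {t : ℝ} (hg : DifferentiableAt ℝ g (x t, u t))
    (hx : HasDerivAt x x' t) (hu : HasDerivAt u u' t) :
    HasDerivAt (fun s => g (x s, u s))
      (fderiv ℝ (fun y => g (y, u t)) (x t) x' + fderiv ℝ (fun v => g (x t, v)) (u t) u') t := by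
  have h₁ : HasFDerivAt (fun y => g (y, u t)) _ (x t) :=
    hg.hasFDerivAt.comp (x t) (hasFDerivAt_prodMk_left (x t) (u t))
  have h₂ : HasFDerivAt (fun v => g (x t, v)) _ (u t) :=
    hg.hasFDerivAt.comp (u t) (hasFDerivAt_prodMk_right (x t) (u t))
  rw [h₁.fderiv, h₂.fderiv]
  refine (hg.hasFDerivAt.comp_hasDerivAt t (hx.prodMk hu)).congr_deriv ?_
  simp [← map_add]

/-- Proposition 3.3: with speed-up gain `α` multiplying the term
`r(t+T) − ŷ(t+T)` and an additive error `E₂`, the asymptotic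
prediction-tracking error is bounded by `η₂/α`. -/
theorem speedup_controller_with_error_tracking_bound
    (n m : ℕ) (hn : 1 ≤ n) (hm : 1 ≤ m)
    (f : EuclideanSpace ℝ (Fin n) × EuclideanSpace ℝ (Fin m) → EuclideanSpace ℝ (Fin n))
    (hf : Continuous f)
    (g : EuclideanSpace ℝ (Fin n) × EuclideanSpace ℝ (Fin m) → EuclideanSpace ℝ (Fin m))
    (hg : ContDiff ℝ 1 g)
    (r : ℝ → EuclideanSpace ℝ (Fin m))
    (hr : Differentiable ℝ r)
    (T : ℝ) (hT : 0 < T)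
    (α : ℝ) (hα : 0 < α)
    (E₂ : ℝ → EuclideanSpace ℝ (Fin m))
    (hE₂ : Continuous E₂)
    (x : ℝ → EuclideanSpace ℝ (Fin n))
    (u : ℝ → EuclideanSpace ℝ (Fin m))
    (hx : ∀ t : ℝ, 0 ≤ t → HasDerivAt x (f (x t, u t)) t)
    (hu : ∀ t : ℝ, 0 ≤ t →
      ∃ J : EuclideanSpace ℝ (Fin m) ≃L[ℝ] EuclideanSpace ℝ (Fin m),
        (J : EuclideanSpace ℝ (Fin m) →L[ℝ] EuclideanSpace ℝ (Fin m)) =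
          fderiv ℝ (fun u' => g (x t, u')) (u t) ∧
        HasDerivAt u
          (J.symm (α • (r (t + T) - g (x t, u t)) + deriv r (t + T) -
            (fderiv ℝ (fun x' => g (x', u t)) (x t)) (f (x t, u t)) + E₂ t)) t) :
    Filter.limsup (fun t => (‖r (t + T) - g (x t, u t)‖₊ : ℝ≥0∞)) Filter.atTop ≤
      (Filter.limsup (fun t => (‖E₂ t‖₊ : ℝ≥0∞)) Filter.atTop) / ENNReal.ofReal α := by
  refine limsup_nnnorm_le_div_of_hasDerivAt hα fun t ht => ?_
  obtain ⟨J, hJ, hut⟩ := hu t ht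
  have hr' : HasDerivAt (fun s => r (s + T)) (deriv r (t + T)) t :=
    (hr (t + T)).hasDerivAt.comp_add_const t T
  have hgt := hasDerivAt_comp_prodMk_partial (hg.differentiable one_ne_zero _) (hx t ht) hut
  rw [← hJ, ContinuousLinearEquiv.coe_coe, J.apply_symm_apply] at hgt
  exact (hr'.sub hgt).congr_deriv (by module)
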